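/- Let (Cₙ)_{n≥1} be a sequence of pairwise disjoint connected subsets of a dendrite (X, d). Then lim_{n→∞} diam(Cₙ) = 0. -/

import Mathlib

open Set Metric Filter

/-- A dendrite: a compact, connected, locally connected metric(izable) space
containing no subspace homeomorphic to the circle. -/
def IsDendrite (X : Type*) [TopologicalSpace X] : Prop :=
  CompactSpace X ∧ ConnectedSpace X ∧ LocallyConnectedSpace X ∧
    ∀ s : Set X, ¬ Nonempty (s ≃ₜ (Metric.sphere (0 : ℂ) 1 : Set ℂ))

/-- `A` is an arc from `x` to `y`: the image of an injective continuous map of `[0,1]`. -/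
def IsArc {X : Type*} [TopologicalSpace X] (A : Set X) (x y : X) : Prop :=
  ∃ γ : unitInterval → X, Continuous γ ∧ Function.Injective γ ∧
    γ 0 = x ∧ γ 1 = y ∧ A = Set.range γ


section Helpers
open Topology

lemma hp_ulc {X : Type*} [MetricSpace X] [CompactSpace X] [LocallyConnectedSpace X]
    {ε : ℝ} (hε : 0 < ε) : ∃ δ > 0, δ ≤ ε ∧ ∀ a b : X, dist a b < δ →
      ∃ S : Set X, IsPreconnected S ∧ a ∈ S ∧ b ∈ S ∧ ∀ u ∈ S, dist u a ≤ ε := by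
  have h : ∀ x : X, ∃ V : Set X, V ⊆ ball x (ε / 2) ∧ IsOpen V ∧ x ∈ V ∧ IsConnected V := fun x =>
    locallyConnectedSpace_iff_subsets_isOpen_isConnected.1 inferInstance x _
      (ball_mem_nhds x (half_pos hε))
  choose V hV1 hV2 hV3 hV4 using h
  obtain ⟨δ, hδ, h⟩ := lebesgue_number_lemma_of_metric (isCompact_univ (X := X)) hV2
    (fun x _ => mem_iUnion.2 ⟨x, hV3 x⟩)
  refine ⟨min δ ε, lt_min hδ hε, min_le_right _ _, fun a b hab => ?_⟩
  obtain ⟨i, hi⟩ := h a (mem_univ _)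
  have ha : a ∈ V i := hi (mem_ball_self hδ)
  refine ⟨V i, (hV4 i).isPreconnected, ha, hi ?_, fun u hu => ?_⟩
  · rw [mem_ball, dist_comm]; exact hab.trans_le (min_le_left _ _)
  · have h1 := mem_ball.1 (hV1 i hu)
    have h2 := mem_ball.1 (hV1 i ha)
    have := dist_triangle_right u a i
    linarith

lemma hp_chain {X : Type*} [MetricSpace X] {S : Set X} (hS : IsPreconnected S) {a b : X}
    (ha : a ∈ S) (hb : b ∈ S) {δ : ℝ} (hδ : 0 < δ) :
    ∃ (M : ℕ) (u : ℕ → X), u 0 = a ∧ (∀ k, M ≤ k → u k = b) ∧ (∀ k, u k ∈ S) ∧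
      ∀ k, dist (u k) (u (k + 1)) < δ := by
  have key : Relation.ReflTransGen (fun x y : X => x ∈ S ∧ y ∈ S ∧ dist x y < δ) a b := by
    refine hS.induction₂' (fun x y => Relation.ReflTransGen
      (fun x y : X => x ∈ S ∧ y ∈ S ∧ dist x y < δ) x y) ?_ ?_ ha hb
    · intro x hx
      filter_upwards [self_mem_nhdsWithin, mem_nhdsWithin_of_mem_nhds (ball_mem_nhds x hδ)]
        with y hy hy2
      have h2 : dist y x < δ := hy2
      exact ⟨.single ⟨hx, hy, by rwa [dist_comm]⟩, .single ⟨hy, hx, h2⟩⟩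
    · intro x y z _ _ _ h1 h2
      exact h1.trans h2
  induction key with
  | refl => exact ⟨0, fun _ => a, rfl, fun _ _ => rfl, fun _ => ha, fun _ => by simpa using hδ⟩
  | tail _ hR ih =>
    rename_i b c _
    obtain ⟨M, u, h0, h1, h2, h3⟩ := ih hR.1
    refine ⟨M + 1, fun k => if k ≤ M then u k else c, by simpa using h0, fun k hk => ?_,
      fun k => ?_, fun k => ?_⟩
    · simp [show ¬ k ≤ M by omega]
    · dsimp only; split_ifs
      · exact h2 k
      · exact hR.2.1
    · dsimp only
      rcases lt_trichotomy k M with h | h | h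
      · rw [if_pos h.le, if_pos (by omega)]; exact h3 k
      · rw [if_pos h.le, if_neg (by omega), h1 k h.ge]; exact hR.2.2
      · rw [if_neg (by omega), if_neg (by omega)]; simpa using hδ

/-- refinement step -/
lemma hp_step {X : Type*} [MetricSpace X] {ε δ δ' : ℝ} (hδ' : 0 < δ')
    (H : ∀ a b : X, dist a b < δ →
      ∃ S : Set X, IsPreconnected S ∧ a ∈ S ∧ b ∈ S ∧ ∀ u ∈ S, dist u a ≤ ε)
    {x y : X} (N : ℕ) (u : ℕ → X) (hN : 0 < N) (h0 : u 0 = x) (h1 : ∀ k, N ≤ k → u k = y)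
    (h2 : ∀ k, dist (u k) (u (k + 1)) < δ) :
    ∃ (M : ℕ) (v : ℕ → X), 0 < M ∧ v 0 = x ∧ (∀ k, N * M ≤ k → v k = y) ∧
      (∀ k, dist (v k) (v (k + 1)) < δ') ∧ ∀ m, dist (v m) (u (m / M)) ≤ ε := by
  have hc : ∀ k, ∃ (M : ℕ) (w : ℕ → X), w 0 = u k ∧ (∀ j, M ≤ j → w j = u (k + 1)) ∧
      (∀ j, dist (w j) (u k) ≤ ε) ∧ ∀ j, dist (w j) (w (j + 1)) < δ' := by
    intro k
    obtain ⟨S, hS, ha, hb, hd⟩ := H _ _ (h2 k)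
    obtain ⟨M, w, a1, a2, a3, a4⟩ := hp_chain hS ha hb hδ'
    exact ⟨M, w, a1, a2, fun j => hd _ (a3 j), a4⟩
  choose M w w0 w1 w2 w3 using hc
  have hw : ∀ k, N ≤ k → ∃ w' : ℕ → X, (∀ j, w' j = y) := fun k _ => ⟨fun _ => y, fun _ => rfl⟩
  -- modify for k ≥ N
  let w' : ℕ → ℕ → X := fun k j => if k < N then w k j else y
  let L := (∑ k ∈ Finset.range N, M k) + 1
  have hL : ∀ k, k < N → M k ≤ L := fun k hk =>
    (Finset.single_le_sum (f := M) (fun _ _ => Nat.zero_le _) (Finset.mem_range.2 hk)).trans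
      (Nat.le_succ _)
  have hε : 0 ≤ ε := dist_nonneg.trans (w2 0 0)
  have e0 : ∀ k, w' k 0 = u k := by
    intro k; simp only [w']; split_ifs with h
    · exact w0 k
    · rw [h1 k (by omega)]
  have eL : ∀ k, w' k L = u (k + 1) := by
    intro k; simp only [w']; split_ifs with h
    · exact w1 k _ (hL k h)
    · rw [h1 (k + 1) (by omega)]
  have e3 : ∀ k j, dist (w' k j) (w' k (j + 1)) < δ' := by
    intro k j; simp only [w']; split_ifs with h
    · exact w3 k j
    · simpa using hδ'
  have e2 : ∀ k j, dist (w' k j) (u k) ≤ ε := by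
    intro k j; simp only [w']; split_ifs with h
    · exact w2 k j
    · rw [h1 k (by omega)]; simpa using hε
  have hLpos : 0 < L := Nat.succ_pos _
  refine ⟨L, fun m => w' (m / L) (m % L), hLpos, ?_, ?_, ?_, ?_⟩
  · simp only [Nat.zero_div, Nat.zero_mod, e0, h0]
  · intro k hk
    have : N ≤ k / L := (Nat.le_div_iff_mul_le hLpos).2 hk
    simp only [w', if_neg (not_lt.2 this)]
  · intro k
    have hk := Nat.mod_lt k hLpos
    have hdm := Nat.div_add_mod k L
    by_cases hlt : k % L + 1 < L
    · have h1 : (k + 1) / L = k / L := by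
        rw [Nat.div_eq_iff hLpos, mul_comm (k / L) L]; constructor <;> omega
      have h2 : (k + 1) % L = k % L + 1 := by
        have := Nat.div_add_mod (k + 1) L
        rw [h1] at this; omega
      simp only [h1, h2]; exact e3 _ _
    · have hl : k % L + 1 = L := by omega
      have hk1 : k + 1 = L * (k / L + 1) := by rw [mul_add]; omega
      have h1 : (k + 1) / L = k / L + 1 := by rw [hk1]; exact Nat.mul_div_cancel_left _ hLpos
      have h2 : (k + 1) % L = 0 := by rw [hk1]; exact Nat.mul_mod_right _ _
      simp only [h1, h2, e0]
      have := e3 (k / L) (k % L)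
      rwa [hl, eL] at this
  · intro m; exact e2 _ _

lemma hp_path {X : Type*} [MetricSpace X] [CompactSpace X] [LocallyConnectedSpace X]
    (x : X) {ε : ℝ} (hε : 0 < ε) : ∃ δ > 0, ∀ y, dist x y < δ → JoinedIn (ball x ε) x y := by
  have hpos : ∀ n : ℕ, 0 < ε / 8 * (1 / 2 : ℝ) ^ n := fun n => by positivity
  have hd := fun n => hp_ulc (X := X) (hpos n)
  choose δ δpos δle hδ using hd
  refine ⟨δ 0, δpos 0, fun y hy => ?_⟩
  let P : ℕ → ℕ × (ℕ → X) → Prop := fun n p =>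
    0 < p.1 ∧ p.2 0 = x ∧ (∀ k, p.1 ≤ k → p.2 k = y) ∧ ∀ k, dist (p.2 k) (p.2 (k + 1)) < δ n
  have hstep : ∀ n (p : {p // P n p}), ∃ q : {q // P (n + 1) q}, ∃ M, 0 < M ∧
      q.1.1 = p.1.1 * M ∧ ∀ m, dist (q.1.2 m) (p.1.2 (m / M)) ≤ ε / 8 * (1 / 2 : ℝ) ^ n := by
    rintro n ⟨⟨N, u⟩, hN, h0, h1, h2⟩
    obtain ⟨M, v, a1, a2, a3, a4, a5⟩ := hp_step (δpos (n + 1)) (hδ n) N u hN h0 h1 h2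
    exact ⟨⟨(N * M, v), Nat.mul_pos hN a1, a2, a3, a4⟩, M, a1, rfl, a5⟩
  choose q hq using hstep
  have hinit : P 0 (1, fun k => if k = 0 then x else y) := by
    refine ⟨one_pos, by simp, fun k hk => ?_, fun k => ?_⟩
    · have : k ≠ 0 := by simp only at hk; omega
      simp [this]
    · rcases Nat.eq_zero_or_pos k with h | h
      · simpa [h] using hy
      · simpa [h.ne'] using δpos 0
  let s : ∀ n, {p // P n p} := fun n => Nat.rec ⟨_, hinit⟩ (fun n p => q n p) n
  let F : ℕ → ℝ → X := fun n t => (s n).1.2 ⌊t * ((s n).1.1 : ℝ)⌋₊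
  have hF : ∀ t n, dist (F n t) (F (n + 1) t) ≤ ε / 8 * (1 / 2 : ℝ) ^ n := by
    intro t n
    obtain ⟨M, hM, hM1, hM2⟩ := hq n (s n)
    have e : s (n + 1) = q n (s n) := rfl
    have := hM2 ⌊t * ((s (n + 1)).1.1 : ℝ)⌋₊
    rw [← Nat.floor_div_natCast, e, hM1] at this
    have hM' : (M : ℝ) ≠ 0 := by positivity
    rw [Nat.cast_mul, ← mul_assoc, mul_div_assoc, div_self hM', mul_one] at this
    rw [dist_comm]
    simp only [F]
    rw [e, hM1, Nat.cast_mul, ← mul_assoc]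
    exact this
  have hcau : ∀ t, ∃ l, Tendsto (fun n => F n t) atTop (𝓝 l) := fun t =>
    cauchySeq_tendsto_of_complete (cauchySeq_of_le_geometric _ _ (by norm_num) (hF t))
  choose f hf using hcau
  have hff : ∀ t n, dist (F n t) (f t) ≤ ε / 4 * (1 / 2 : ℝ) ^ n := by
    intro t n
    have := dist_le_of_le_geometric_of_tendsto _ _ (by norm_num) (hF t) (hf t) n
    refine this.trans (le_of_eq (by ring))
  have hcont : Continuous f := by
    rw [Metric.continuous_iff]
    intro t η hη
    obtain ⟨n, hn⟩ := exists_pow_lt_of_lt_one (show 0 < η / ε by positivity)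
      (show (1 / 2 : ℝ) < 1 by norm_num)
    have hn' : ε * (1 / 2 : ℝ) ^ n < η := by rw [lt_div_iff₀ hε] at hn; linarith
    obtain ⟨hN, h0, h1, h2⟩ := (s n).2
    have hNp : (0 : ℝ) < (s n).1.1 := by exact_mod_cast hN
    refine ⟨1 / ((s n).1.1 : ℝ), by positivity, fun r hr => ?_⟩
    have hFn : ∀ a b : ℝ, a ≤ b → b - a < 1 / ((s n).1.1 : ℝ) → dist (F n a) (F n b) < δ n := by
      intro a b hab hba
      have h3 : ⌊a * ((s n).1.1 : ℝ)⌋₊ ≤ ⌊b * ((s n).1.1 : ℝ)⌋₊ :=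
        Nat.floor_le_floor (by gcongr)
      have h4 : ⌊b * ((s n).1.1 : ℝ)⌋₊ ≤ ⌊a * ((s n).1.1 : ℝ)⌋₊ + 1 := by
        rcases le_or_gt 0 a with ha | ha
        · rw [← Nat.floor_add_one (by positivity)]
          refine Nat.floor_le_floor ?_
          rw [lt_div_iff₀ hNp] at hba; linarith
        · refine Nat.le_trans (Nat.floor_le_of_le (n := 1) ?_) (Nat.le_add_left _ _)
          rw [lt_div_iff₀ hNp] at hba
          have : a * ((s n).1.1 : ℝ) ≤ 0 := mul_nonpos_of_nonpos_of_nonneg ha.le hNp.le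
          push_cast; linarith
      simp only [F]
      rcases Nat.le_or_eq_of_le_succ h4 with h | h
      · rw [le_antisymm h h3]; simpa using δpos n
      · rw [h]; exact h2 _
    have h5 : dist (F n r) (F n t) < δ n := by
      rw [Real.dist_eq] at hr
      rcases le_total r t with h | h
      · exact hFn _ _ h (by rw [abs_sub_comm] at hr; exact (le_abs_self _).trans_lt hr)
      · rw [dist_comm]; exact hFn _ _ h ((le_abs_self _).trans_lt hr)
    have h6 := hff r n
    have h7 := hff t n
    have h8 := δle n
    have h9 := dist_triangle4 (f r) (F n r) (F n t) (f t)
    rw [dist_comm (f r) (F n r)] at h9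
    have := hpos n
    nlinarith
  have f0 : f 0 = x := by
    refine tendsto_nhds_unique (hf 0) ?_
    have : (fun n => F n 0) = fun _ => x := by
      funext n; simp only [F, zero_mul, Nat.floor_zero]; exact (s n).2.2.1
    rw [this]; exact tendsto_const_nhds
  have f1 : f 1 = y := by
    refine tendsto_nhds_unique (hf 1) ?_
    have : (fun n => F n 1) = fun _ => y := by
      funext n; simp only [F, one_mul, Nat.floor_natCast]; exact (s n).2.2.2.1 _ le_rfl
    rw [this]; exact tendsto_const_nhds
  refine ⟨⟨⟨fun t => f t, by fun_prop⟩, by simpa using f0, by simpa using f1⟩, fun t => ?_⟩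
  change dist (f t) x < ε
  have h1 := hff t 0
  have h2 : dist x (F 0 t) < δ 0 := by
    change dist x (if _ then x else y) < δ 0
    split_ifs
    · simpa using δpos 0
    · exact hy
  have h3 := δle 0
  have h4 := dist_triangle_left (f t) x (F 0 t)
  rw [dist_comm x] at h2
  simp only [pow_zero, mul_one] at *
  linarith

lemma hp_lpc {X : Type*} [MetricSpace X] [CompactSpace X] [LocallyConnectedSpace X] :
    LocallyPathConnectedSpace X := by
  refine ⟨fun x => ?_⟩
  rw [hasBasis_self]
  intro t ht
  obtain ⟨ε, hε, hb⟩ := Metric.mem_nhds_iff.1 ht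
  obtain ⟨δ, hδ, h⟩ := hp_path x hε
  refine ⟨pathComponentIn (ball x ε) x, ?_, isPathConnected_pathComponentIn (mem_ball_self hε),
    pathComponentIn_subset.trans hb⟩
  filter_upwards [ball_mem_nhds x hδ] with y hy
  exact h y (by rw [dist_comm]; exact hy)

lemma hp_minset {X : Type*} [MetricSpace X] (γ : ℝ → X) (hγ : Continuous γ) :
    ∃ A : Set ℝ, IsClosed A ∧ A ⊆ Icc 0 1 ∧ 0 ∈ A ∧ 1 ∈ A ∧
      (∀ s ∈ A, ∀ t ∈ A, s < t → (∀ u ∈ A, s < u → ¬ u < t) → γ s = γ t) ∧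
      (∀ s ∈ A, ∀ t ∈ A, s < t → γ s = γ t → (∀ u ∈ A, s < u → ¬ u < t)) := by
  let Z : Set (Set ℝ) := {A | IsClosed A ∧ A ⊆ Icc 0 1 ∧ 0 ∈ A ∧ 1 ∈ A ∧
      (∀ s ∈ A, ∀ t ∈ A, s < t → (∀ u ∈ A, s < u → ¬ u < t) → γ s = γ t)}
  have hI : Icc (0 : ℝ) 1 ∈ Z := by
    refine ⟨isClosed_Icc, Subset.rfl, by simp, by simp, fun s hs t ht hst h => ?_⟩
    exact absurd (show (s + t) / 2 < t by linarith)
      (h ((s + t) / 2) ⟨by linarith [hs.1, ht.1], by linarith [hs.2, ht.2]⟩ (by linarith))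
  obtain ⟨A, -, hA⟩ := zorn_superset_nonempty Z (by
    intro c hc hchain hne
    refine ⟨⋂₀ c, ⟨isClosed_sInter fun B hB => (hc hB).1, ?_, fun B hB => (hc hB).2.2.1,
      fun B hB => (hc hB).2.2.2.1, ?_⟩, fun B hB => sInter_subset_of_mem hB⟩
    · obtain ⟨B, hB⟩ := hne
      exact (sInter_subset_of_mem hB).trans (hc hB).2.1
    · intro s hs t ht hst hgap
      by_contra hne'
      have hε : 0 < dist (γ s) (γ t) / 2 := half_pos (dist_pos.2 hne')
      obtain ⟨δ1, hδ1, h1⟩ := Metric.continuous_iff.1 hγ s _ hε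
      obtain ⟨δ2, hδ2, h2⟩ := Metric.continuous_iff.1 hγ t _ hε
      obtain ⟨η, hη, hη'⟩ := exists_between (lt_min (lt_min hδ1 hδ2) (half_pos (sub_pos.2 hst)))
      rw [lt_min_iff, lt_min_iff] at hη'
      obtain ⟨⟨hη1, hη2⟩, hη3⟩ := hη'
      have hex : ∃ B ∈ c, B ∩ Icc (s + η) (t - η) = ∅ := by
        by_contra hcon
        push Not at hcon
        haveI : Nonempty c := hne.to_subtype
        obtain ⟨u, hu⟩ := IsCompact.nonempty_iInter_of_directed_nonempty_isCompact_isClosed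
          (fun B : c => (B : Set ℝ) ∩ Icc (s + η) (t - η))
          (by
            intro B B'
            rcases hchain.total B.2 B'.2 with h | h
            · exact ⟨B, Subset.rfl, inter_subset_inter_left _ h⟩
            · exact ⟨B', inter_subset_inter_left _ h, Subset.rfl⟩)
          (fun B => hcon B B.2)
          (fun B => isCompact_Icc.inter_left (hc B.2).1)
          (fun B => (hc B.2).1.inter isClosed_Icc)
        rw [mem_iInter] at hu
        have hu2 := (hu (Classical.arbitrary c)).2
        exact hgap u (fun B hB => (hu ⟨B, hB⟩).1) (by linarith [hu2.1]) (by linarith [hu2.2])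
      obtain ⟨B, hB, hBe⟩ := hex
      obtain ⟨s', ⟨hs1, hs2⟩, hs3⟩ := ((isCompact_Icc (a := s) (b := s + η)).inter_left (hc hB).1).exists_isGreatest
        ⟨s, hs B hB, le_rfl, by linarith⟩
      obtain ⟨t', ⟨ht1, ht2⟩, ht3⟩ := ((isCompact_Icc (a := t - η) (b := t)).inter_left (hc hB).1).exists_isLeast
        ⟨t, ht B hB, by linarith, le_rfl⟩
      have heq := (hc hB).2.2.2.2 s' hs1 t' ht1 (by linarith [hs2.2, ht2.1]) (by
        intro u hu hsu hut
        rcases le_or_gt u (s + η) with h | h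
        · exact absurd (hs3 ⟨hu, by linarith [hs2.1], h⟩) (not_le.2 hsu)
        rcases le_or_gt (t - η) u with h' | h'
        · exact absurd (ht3 ⟨hu, h', by linarith [ht2.2]⟩) (not_le.2 hut)
        · have : u ∈ B ∩ Icc (s + η) (t - η) := ⟨hu, h.le, h'.le⟩
          rw [hBe] at this; exact this)
      have d1 := h1 s' (by rw [Real.dist_eq, abs_lt]; constructor <;> linarith [hs2.1, hs2.2])
      have d2 := h2 t' (by rw [Real.dist_eq, abs_lt]; constructor <;> linarith [ht2.1, ht2.2])
      rw [← heq] at d2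
      have := dist_triangle_left (γ s) (γ t) (γ s')
      linarith) _ hI
  obtain ⟨a1, a2, a3, a4, a5⟩ := hA.prop
  refine ⟨A, a1, a2, a3, a4, a5, fun s hs t ht hst he u hu hsu hut => ?_⟩
  have hmem : A \ Ioo s t ∈ Z := by
    refine ⟨a1.sdiff isOpen_Ioo, sdiff_subset.trans a2, ⟨a3, fun h => ?_⟩, ⟨a4, fun h => ?_⟩, ?_⟩
    · linarith [h.1, (a2 hs).1]
    · linarith [h.2, (a2 ht).2]
    · rintro v ⟨hv, hv'⟩ w ⟨hw, hw'⟩ hvw hg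
      have hsA : s ∈ A \ Ioo s t := ⟨hs, fun h => lt_irrefl _ h.1⟩
      have htA : t ∈ A \ Ioo s t := ⟨ht, fun h => lt_irrefl _ h.2⟩
      have gen : (w ≤ s ∨ t ≤ v) → γ v = γ w := by
        intro h
        refine a5 v hv w hw hvw fun x hx hvx hxw => hg x ⟨hx, fun h' => ?_⟩ hvx hxw
        rcases h with h | h <;> linarith [h'.1, h'.2]
      rcases le_or_gt w s with h1 | h1
      · exact gen (Or.inl h1)
      rcases le_or_gt t v with h2 | h2
      · exact gen (Or.inr h2)
      have h3 : v ≤ s := by by_contra h; exact hv' ⟨not_le.1 h, h2⟩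
      have h4 : t ≤ w := by by_contra h; exact hw' ⟨h1, not_le.1 h⟩
      have h5 : v = s := le_antisymm h3 (not_lt.1 fun h => hg s hsA h h1)
      have h6 : w = t := le_antisymm (not_lt.1 fun h => hg t htA h2 h) h4
      rw [h5, h6, he]
  exact (hA.le_of_le hmem sdiff_subset hu).2 ⟨hsu, hut⟩

/-- running maximum along `A` -/
noncomputable def hpS (A : Set ℝ) (f : ℝ → ℝ) (t : ℝ) : ℝ := sSup (f '' (A ∩ Iic t))

lemma hpS_le {A : Set ℝ} {f : ℝ → ℝ} {t M : ℝ} (ht : t ∈ A) (h : ∀ s ∈ A, s ≤ t → f s ≤ M) :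
    hpS A f t ≤ M :=
  csSup_le ⟨f t, t, ⟨ht, self_mem_Iic⟩, rfl⟩ (by rintro _ ⟨s, ⟨hs, hst⟩, rfl⟩; exact h s hs hst)

lemma le_hpS {A : Set ℝ} {f : ℝ → ℝ} (hf : ∀ s, f s ≤ 1) {s t : ℝ} (hs : s ∈ A) (hst : s ≤ t) :
    f s ≤ hpS A f t :=
  le_csSup ⟨1, by rintro _ ⟨s, -, rfl⟩; exact hf s⟩ ⟨s, ⟨hs, hst⟩, rfl⟩

lemma hpS_mono {A : Set ℝ} {f : ℝ → ℝ} (hf : ∀ s, f s ≤ 1) : MonotoneOn (hpS A f) A :=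
  fun _ hs _ _ hst => hpS_le hs fun _ hu hus => le_hpS hf hu (hus.trans hst)

lemma hpS_cont {A : Set ℝ} {f : ℝ → ℝ} (hA' : A ⊆ Icc 0 1)
    (hf : ∀ s, f s ≤ 1) (hc : Continuous f) : ContinuousOn (hpS A f) A := by
  have huc := (isCompact_Icc (a := (0 : ℝ)) (b := 1)).uniformContinuousOn_of_continuous hc.continuousOn
  rw [Metric.uniformContinuousOn_iff] at huc
  rw [Metric.continuousOn_iff]
  intro t ht ε hε
  obtain ⟨δ, hδ, h⟩ := huc (ε / 2) (half_pos hε)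
  refine ⟨δ, hδ, fun s hs hst => ?_⟩
  have key : ∀ a ∈ A, ∀ b ∈ A, a ≤ b → dist a b < δ → hpS A f b ≤ hpS A f a + ε / 2 := by
    intro a ha b hb hab hd
    refine hpS_le hb fun u hu hub => ?_
    rcases le_total u a with h1 | h1
    · linarith [le_hpS hf hu h1]
    · have := h u (hA' hu) a (hA' ha) (by
        rw [Real.dist_eq, abs_lt] at *; constructor <;> linarith)
      rw [Real.dist_eq, abs_lt] at this
      linarith [le_hpS hf ha le_rfl]
  rw [Real.dist_eq, abs_lt]
  rcases le_total s t with h1 | h1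
  · have := key s hs t ht h1 hst
    have := hpS_mono hf hs ht h1
    constructor <;> linarith
  · have := key t ht s hs h1 (by rwa [dist_comm])
    have := hpS_mono hf ht hs h1
    constructor <;> linarith

lemma hp_height {X : Type*} [MetricSpace X] (γ : ℝ → X) (hγ : Continuous γ) (A : Set ℝ)
    (hA : IsClosed A) (hA' : A ⊆ Icc 0 1)
    (hM : ∀ s ∈ A, ∀ t ∈ A, s < t → γ s = γ t → (∀ u ∈ A, s < u → ¬ u < t)) :
    ∃ h : ℝ → ℝ, ContinuousOn h A ∧ MonotoneOn h A ∧
      ∀ s ∈ A, ∀ t ∈ A, (h s = h t ↔ γ s = γ t) := by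
  have hAc : IsCompact A := isCompact_Icc.of_isClosed_subset hA hA'
  let F : ℚ → ℝ → ℝ := fun r s => min 1 (infDist (γ s) (γ '' (A ∩ Iic (r : ℝ))))
  have F1 : ∀ r s, F r s ≤ 1 := fun r s => min_le_left _ _
  have F0 : ∀ r s, 0 ≤ F r s := fun r s => le_min zero_le_one infDist_nonneg
  have Fc : ∀ r, Continuous (F r) := fun r =>
    continuous_const.min ((continuous_infDist_pt _).comp hγ)
  let R : ℕ → ℚ := fun n => (Denumerable.eqv ℚ).symm n
  have S0 : ∀ r, ∀ t ∈ A, 0 ≤ hpS A (F r) t := fun r t ht =>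
    (F0 r t).trans (le_hpS (F1 r) ht le_rfl)
  have S1 : ∀ r, ∀ t ∈ A, hpS A (F r) t ≤ 1 := fun r t ht => hpS_le ht fun s _ _ => F1 r s
  have hsum2 : Summable fun n : ℕ => (1 / 2 : ℝ) ^ n :=
    summable_geometric_of_lt_one (by norm_num) (by norm_num)
  have hbd : ∀ n, ∀ t ∈ A, ‖(1 / 2 : ℝ) ^ n * hpS A (F (R n)) t‖ ≤ (1 / 2 : ℝ) ^ n := by
    intro n t ht
    rw [Real.norm_of_nonneg (mul_nonneg (by positivity) (S0 _ t ht))]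
    exact mul_le_of_le_one_right (by positivity) (S1 _ t ht)
  have hsum : ∀ t ∈ A, Summable fun n : ℕ => (1 / 2 : ℝ) ^ n * hpS A (F (R n)) t := fun t ht =>
    Summable.of_norm_bounded hsum2 (fun n => hbd n t ht)
  have hmono : ∀ s ∈ A, ∀ t ∈ A, s ≤ t → ∀ n, (1 / 2 : ℝ) ^ n * hpS A (F (R n)) s ≤
      (1 / 2 : ℝ) ^ n * hpS A (F (R n)) t := fun s hs t ht hst n =>
    mul_le_mul_of_nonneg_left (hpS_mono (F1 _) hs ht hst) (by positivity)
  let h : ℝ → ℝ := fun t => ∑' n : ℕ, (1 / 2 : ℝ) ^ n * hpS A (F (R n)) t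
  have key : ∀ s ∈ A, ∀ t ∈ A, s < t → (h s = h t ↔ γ s = γ t) := by
    intro s hs t ht hst
    constructor
    · intro he
      by_contra hne
      have hnot : γ t ∉ γ '' (A ∩ Iic s) := by
        rintro ⟨u, ⟨hu, hus⟩, hut⟩
        rcases eq_or_lt_of_le (show u ≤ s from hus) with rfl | h1
        · exact hne hut
        · exact hM u hu t ht (h1.trans hst) hut s hs h1 hst
      have hK : IsClosed (γ '' (A ∩ Iic s)) :=
        ((hAc.inter_right isClosed_Iic).image hγ).isClosed
      have hpos := (hK.notMem_iff_infDist_pos ⟨γ s, s, ⟨hs, self_mem_Iic⟩, rfl⟩).1 hnot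
      set D := infDist (γ t) (γ '' (A ∩ Iic s)) with hD
      obtain ⟨δ, hδ, h1⟩ := Metric.continuous_iff.1 hγ s _ (half_pos hpos)
      obtain ⟨r, hr1, hr2⟩ := exists_rat_btwn (show s < s + δ by linarith)
      have hDr : D / 2 ≤ infDist (γ t) (γ '' (A ∩ Iic (r : ℝ))) := by
        have hne' : (γ '' (A ∩ Iic (r : ℝ))).Nonempty := ⟨γ s, s, ⟨hs, hr1.le⟩, rfl⟩
        rw [le_infDist hne']
        rintro _ ⟨u, ⟨hu, hur⟩, rfl⟩
        have hur : u ≤ r := hur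
        rcases le_or_gt u s with h2 | h2
        · have : D ≤ dist (γ t) (γ u) := infDist_le_dist_of_mem ⟨u, ⟨hu, h2⟩, rfl⟩
          linarith
        · have h3 : D ≤ dist (γ t) (γ s) := infDist_le_dist_of_mem ⟨s, ⟨hs, self_mem_Iic⟩, rfl⟩
          have h4 := h1 u (by rw [Real.dist_eq, abs_lt]; constructor <;> linarith)
          have := dist_triangle (γ t) (γ u) (γ s)
          linarith
      have hSt : 0 < hpS A (F r) t :=
        (lt_min one_pos (lt_of_lt_of_le (half_pos hpos) hDr)).trans_le (le_hpS (F1 r) ht le_rfl)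
      have hSs : hpS A (F r) s ≤ 0 := by
        refine hpS_le hs fun u hu hus => (min_le_right _ _).trans (le_of_eq ?_)
        exact infDist_zero_of_mem ⟨u, ⟨hu, hus.trans hr1.le⟩, rfl⟩
      have hRn : R (Denumerable.eqv ℚ r) = r := (Denumerable.eqv ℚ).symm_apply_apply r
      refine absurd he (ne_of_lt ?_)
      refine Summable.tsum_lt_tsum (i := Denumerable.eqv ℚ r) (hmono s hs t ht hst.le) ?_
        (hsum s hs) (hsum t ht)
      rw [hRn]
      exact mul_lt_mul_of_pos_left (hSs.trans_lt hSt) (by positivity)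
    · intro he
      have hg := hM s hs t ht hst he
      have : ∀ r, hpS A (F r) s = hpS A (F r) t := by
        intro r
        refine le_antisymm (hpS_mono (F1 r) hs ht hst.le) (hpS_le ht fun u hu hut => ?_)
        rcases le_or_gt u s with h1 | h1
        · exact le_hpS (F1 r) hu h1
        · have : u = t := le_antisymm hut (not_lt.1 (hg u hu h1))
          have h2 : F r u = F r s := by simp only [F]; rw [this, he]
          rw [h2]; exact le_hpS (F1 r) hs le_rfl
      simp only [h, this]
  refine ⟨h, ?_, ?_, ?_⟩
  · exact continuousOn_tsum (fun n => continuousOn_const.mul (hpS_cont hA' (F1 _) (Fc _)))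
      hsum2 hbd
  · intro s hs t ht hst
    exact Summable.tsum_le_tsum (hmono s hs t ht hst) (hsum s hs) (hsum t ht)
  · intro s hs t ht
    rcases lt_trichotomy s t with h1 | h1 | h1
    · exact key s hs t ht h1
    · subst h1; simp
    · rw [eq_comm, key t ht s hs h1, eq_comm]

lemma hp_arc {X : Type*} [MetricSpace X] (γ : ℝ → X) (hγ : Continuous γ) (hne : γ 0 ≠ γ 1) :
    ∃ f : ℝ → X, Continuous f ∧ InjOn f (Icc 0 1) ∧ f 0 = γ 0 ∧ f 1 = γ 1 ∧
      ∀ t, f t ∈ γ '' Icc 0 1 := by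
  obtain ⟨A, a1, a2, a3, a4, hG, hM⟩ := hp_minset γ hγ
  obtain ⟨h, hc, hmono, hiff⟩ := hp_height γ hγ A a1 a2 hM
  have hAc : IsCompact A := isCompact_Icc.of_isClosed_subset a1 a2
  have hlt : h 0 < h 1 := lt_of_le_of_ne (hmono a3 a4 zero_le_one)
    (fun e => hne ((hiff 0 a3 1 a4).1 e))
  have hmaps : ∀ s : A, h s ∈ Icc (h 0) (h 1) := fun s =>
    ⟨hmono a3 s.2 (a2 s.2).1, hmono s.2 a4 (a2 s.2).2⟩
  have hsurj : ∀ u ∈ Icc (h 0) (h 1), ∃ s ∈ A, h s = u := by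
    intro u hu
    by_contra hcon
    push Not at hcon
    have c1 : IsCompact (A ∩ h ⁻¹' Iic u) :=
      hAc.of_isClosed_subset (hc.preimage_isClosed_of_isClosed a1 isClosed_Iic) inter_subset_left
    have c2 : IsCompact (A ∩ h ⁻¹' Ici u) :=
      hAc.of_isClosed_subset (hc.preimage_isClosed_of_isClosed a1 isClosed_Ici) inter_subset_left
    obtain ⟨s, ⟨hs, hsu⟩, hsm⟩ := c1.exists_isGreatest ⟨0, a3, hu.1⟩
    obtain ⟨t, ⟨ht, htu⟩, htm⟩ := c2.exists_isLeast ⟨1, a4, hu.2⟩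
    have hsu' : h s < u := lt_of_le_of_ne hsu (hcon s hs)
    have htu' : u < h t := lt_of_le_of_ne htu (hcon t ht).symm
    have hst : s < t := by
      by_contra hh
      have := hmono ht hs (not_lt.1 hh)
      linarith
    have := (hiff s hs t ht).2 (hG s hs t ht hst (by
      intro v hv hsv hvt
      rcases le_total (h v) u with h1 | h1
      · exact absurd (hsm ⟨hv, h1⟩) (not_le.2 hsv)
      · exact absurd (htm ⟨hv, h1⟩) (not_le.2 hvt)))
    linarith
  haveI : CompactSpace A := isCompact_iff_compactSpace.1 hAc
  let g : A → Icc (h 0) (h 1) := fun s => ⟨h s, hmaps s⟩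
  have hgc : Continuous g := (continuousOn_iff_continuous_domRestrict.1 hc).subtype_mk _
  have hgs : Function.Surjective g := by
    rintro ⟨u, hu⟩
    obtain ⟨s, hs, rfl⟩ := hsurj u hu
    exact ⟨⟨s, hs⟩, rfl⟩
  have hq : IsQuotientMap g := hgc.isClosedMap.isQuotientMap hgc hgs
  choose σ hσ using hgs
  let φ : Icc (h 0) (h 1) → X := fun u => γ (σ u)
  have hφg : ∀ s : A, φ (g s) = γ s := by
    intro s
    exact (hiff _ (σ (g s)).2 _ s.2).1 (congrArg Subtype.val (hσ (g s)))
  have hφ : Continuous φ := by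
    rw [hq.continuous_iff]
    have : φ ∘ g = fun s : A => γ s := funext hφg
    rw [this]; exact hγ.comp continuous_subtype_val
  have hφi : Function.Injective φ := by
    intro u v huv
    rw [← hσ u, ← hσ v]
    exact Subtype.ext ((hiff _ (σ u).2 _ (σ v).2).2 huv)
  have hmem : ∀ t ∈ Icc (0 : ℝ) 1, h 0 + t * (h 1 - h 0) ∈ Icc (h 0) (h 1) := by
    rintro t ⟨h1, h2⟩; constructor <;> nlinarith
  refine ⟨fun t => φ (projIcc (h 0) (h 1) hlt.le (h 0 + t * (h 1 - h 0))),
    hφ.comp (continuous_projIcc.comp (by fun_prop)), ?_, ?_, ?_, ?_⟩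
  · intro s hs t ht hst
    have := hφi hst
    rw [projIcc_of_mem _ (hmem s hs), projIcc_of_mem _ (hmem t ht)] at this
    have := congrArg Subtype.val this
    exact mul_right_cancel₀ (sub_pos.2 hlt).ne' (add_left_cancel this)
  · simp only [zero_mul, add_zero, projIcc_left]
    exact hφg ⟨0, a3⟩
  · simp only [one_mul, add_sub_cancel, projIcc_right]
    exact hφg ⟨1, a4⟩
  · intro t
    exact ⟨_, a2 (σ _).2, rfl⟩

lemma hp_circle {X : Type*} [MetricSpace X]
    (hX : ∀ s : Set X, ¬ Nonempty (s ≃ₜ (Metric.sphere (0 : ℂ) 1 : Set ℂ)))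
    (f : ℝ → X) (hf : ContinuousOn f (Icc 0 2)) (h02 : f 0 = f 2) (hinj : InjOn f (Ico 0 2)) :
    False := by
  haveI : Fact ((0 : ℝ) < 2) := ⟨by norm_num⟩
  let g : AddCircle (2 : ℝ) → X := AddCircle.liftIco 2 0 f
  have hg : Continuous g := AddCircle.liftIco_zero_continuous h02 hf
  have hgi : Function.Injective g := by
    intro a b hab
    have ha : a = ((AddCircle.equivIco (2 : ℝ) 0 a : ℝ) : AddCircle (2 : ℝ)) :=
      ((AddCircle.equivIco (2 : ℝ) 0).symm_apply_apply a).symm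
    have hb : b = ((AddCircle.equivIco (2 : ℝ) 0 b : ℝ) : AddCircle (2 : ℝ)) :=
      ((AddCircle.equivIco (2 : ℝ) 0).symm_apply_apply b).symm
    have h1 : f (AddCircle.equivIco (2 : ℝ) 0 a : ℝ) = f (AddCircle.equivIco (2 : ℝ) 0 b : ℝ) := hab
    have m1 : (AddCircle.equivIco (2 : ℝ) 0 a : ℝ) ∈ Ico (0 : ℝ) 2 := by simpa only [zero_add] using (AddCircle.equivIco (2 : ℝ) 0 a).2
    have m2 : (AddCircle.equivIco (2 : ℝ) 0 b : ℝ) ∈ Ico (0 : ℝ) 2 := by simpa only [zero_add] using (AddCircle.equivIco (2 : ℝ) 0 b).2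
    rw [ha, hb, hinj m1 m2 h1]
  have hemb : IsEmbedding g := (hg.isClosedEmbedding hgi).isEmbedding
  have e1 := hemb.toHomeomorph
  have e2 := AddCircle.homeomorphCircle (T := 2) (by norm_num)
  exact hX (range g) ⟨e1.symm.trans e2⟩

/-- two arcs -/
lemma hp_two_arcs {X : Type*} [MetricSpace X]
    (hX : ∀ s : Set X, ¬ Nonempty (s ≃ₜ (Metric.sphere (0 : ℂ) 1 : Set ℂ)))
    (α β : ℝ → X) (hα : Continuous α) (hβ : Continuous β)
    (iα : InjOn α (Icc 0 1)) (iβ : InjOn β (Icc 0 1)) (h0 : α 0 = β 0) (h1 : α 1 = β 1)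
    (c : ℝ) (hc : c ∈ Icc (0 : ℝ) 1) : α c ∈ β '' Icc 0 1 := by
  by_contra hcb
  have hK : IsClosed (α ⁻¹' (β '' Icc 0 1)) := (isCompact_Icc.image hβ).isClosed.preimage hα
  obtain ⟨a, ⟨ha1, ha2⟩, hamax⟩ := ((isCompact_Icc (a := (0 : ℝ)) (b := c)).inter_right hK).exists_isGreatest
    ⟨0, ⟨le_rfl, hc.1⟩, 0, by simp, h0.symm⟩
  obtain ⟨b, ⟨hb1, hb2⟩, hbmin⟩ := ((isCompact_Icc (a := c) (b := (1 : ℝ))).inter_right hK).exists_isLeast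
    ⟨1, ⟨hc.2, le_rfl⟩, 1, by simp, h1.symm⟩
  have hac : a < c := lt_of_le_of_ne ha1.2 (fun h => hcb (h ▸ ha2))
  have hcb' : c < b := lt_of_le_of_ne hb1.1 (fun h => hcb (h ▸ hb2))
  have hmid : ∀ t, a < t → t < b → α t ∉ β '' Icc 0 1 := by
    intro t hat htb ht
    rcases le_total t c with h | h
    · exact absurd (hamax ⟨⟨ha1.1.trans hat.le, h⟩, ht⟩) (not_le.2 hat)
    · exact absurd (hbmin ⟨⟨h, htb.le.trans hb1.2⟩, ht⟩) (not_le.2 htb)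
  obtain ⟨p, hp, hpa⟩ := ha2
  obtain ⟨q, hq, hqb⟩ := hb2
  have hab : a < b := hac.trans hcb'
  have hpq : p ≠ q := by
    rintro rfl
    have := iα ⟨ha1.1, ha1.2.trans hc.2⟩ ⟨hc.1.trans hb1.1, hb1.2⟩ (hpa.symm.trans hqb)
    linarith
  have key1 : ∀ t : ℝ, t ∈ Icc (0 : ℝ) 1 → a + t * (b - a) ∈ Icc a b := by
    rintro t ⟨t0, t1⟩; constructor <;> nlinarith
  have key2 : ∀ t : ℝ, t ∈ Icc (1 : ℝ) 2 → q + (t - 1) * (p - q) ∈ Icc (0 : ℝ) 1 := by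
    rintro t ⟨t0, t1⟩
    obtain ⟨p0, p1⟩ := hp; obtain ⟨q0, q1⟩ := hq
    constructor <;> nlinarith [mul_nonneg (sub_nonneg.2 t0) p0, mul_nonneg (sub_nonneg.2 t1) q0,
      mul_nonneg (sub_nonneg.2 t0) (sub_nonneg.2 p1), mul_nonneg (sub_nonneg.2 t1) (sub_nonneg.2 q1)]
  let f : ℝ → X := fun t => if t ≤ 1 then α (a + t * (b - a)) else β (q + (t - 1) * (p - q))
  have hf : Continuous f := by
    refine Continuous.if_le (by fun_prop) (by fun_prop) continuous_id continuous_const ?_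
    rintro t rfl
    simp [hqb]
  have hsub : Icc a b ⊆ Icc (0 : ℝ) 1 := Icc_subset_Icc ha1.1 hb1.2
  have mixed : ∀ s t : ℝ, s ∈ Ico (0 : ℝ) 2 → t ∈ Ico (0 : ℝ) 2 → s ≤ 1 → 1 < t → f s ≠ f t := by
    intro s t hs ht hs1 ht1 he
    simp only [f, if_pos hs1, if_neg (not_le.2 ht1)] at he
    have hm := key2 t ⟨ht1.le, ht.2.le⟩
    have h3 : ¬ (a < a + s * (b - a) ∧ a + s * (b - a) < b) := fun h =>
      hmid _ h.1 h.2 ⟨_, hm, he.symm⟩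
    have hs' : s = 0 ∨ s = 1 := by
      by_contra hne
      push Not at hne
      have h0 : 0 < s := lt_of_le_of_ne hs.1 (Ne.symm hne.1)
      have h1 : s < 1 := lt_of_le_of_ne hs1 hne.2
      exact h3 ⟨by nlinarith, by nlinarith⟩
    rcases hs' with rfl | rfl
    · rw [zero_mul, add_zero, ← hpa] at he
      have := iβ hp hm he
      have h4 : (2 - t) * (p - q) = 0 := by linarith
      rcases mul_eq_zero.1 h4 with h | h
      · linarith [ht.2]
      · exact hpq (by linarith)
    · rw [one_mul, add_sub_cancel, ← hqb] at he
      have := iβ hq hm he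
      have h4 : (t - 1) * (p - q) = 0 := by linarith
      rcases mul_eq_zero.1 h4 with h | h
      · linarith
      · exact hpq (by linarith)
  refine hp_circle hX f hf.continuousOn ?_ ?_
  · simp only [f]; norm_num [hpa]
  · intro s hs t ht he
    rcases le_or_gt s 1 with hs1 | hs1 <;> rcases le_or_gt t 1 with ht1 | ht1
    · simp only [f, if_pos hs1, if_pos ht1] at he
      have := iα (hsub (key1 s ⟨hs.1, hs1⟩)) (hsub (key1 t ⟨ht.1, ht1⟩)) he
      exact mul_right_cancel₀ (sub_pos.2 hab).ne' (add_left_cancel this)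
    · exact absurd he (mixed s t hs ht hs1 ht1)
    · exact absurd he.symm (mixed t s ht hs ht1 hs1)
    · simp only [f, if_neg (not_le.2 hs1), if_neg (not_le.2 ht1)] at he
      have := iβ (key2 s ⟨hs1.le, hs.2.le⟩) (key2 t ⟨ht1.le, ht.2.le⟩) he
      have := mul_right_cancel₀ (sub_ne_zero.2 hpq) (add_left_cancel this)
      linarith

lemma hp_joined_arc {X : Type*} [MetricSpace X] {F : Set X} {x y : X} (h : JoinedIn F x y)
    (hne : x ≠ y) : ∃ f : ℝ → X, Continuous f ∧ InjOn f (Icc 0 1) ∧ f 0 = x ∧ f 1 = y ∧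
      ∀ t, f t ∈ F := by
  obtain ⟨p, hp⟩ := h
  obtain ⟨f, h1, h2, h3, h4, h5⟩ := hp_arc p.extend p.continuous_extend (by simpa using hne)
  refine ⟨f, h1, h2, by simpa using h3, by simpa using h4, fun t => ?_⟩
  obtain ⟨s, hs, hst⟩ := h5 t
  rw [← hst, Path.extend_apply p hs]
  exact hp _

/-- An arc lies in every connected set containing its endpoints. -/
lemma hp_arc_sub {X : Type*} [MetricSpace X] [CompactSpace X] [LocallyConnectedSpace X]
    (hX : ∀ s : Set X, ¬ Nonempty (s ≃ₜ (Metric.sphere (0 : ℂ) 1 : Set ℂ)))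
    (α : ℝ → X) (hα : Continuous α) (iα : InjOn α (Icc 0 1)) {A : Set X} (hA : IsPreconnected A)
    (h0 : α 0 ∈ A) (h1 : α 1 ∈ A) (c : ℝ) (hc : c ∈ Icc (0 : ℝ) 1) : α c ∈ A := by
  by_contra hcA
  have hlpc : LocallyPathConnectedSpace X := hp_lpc
  have hAc : A ⊆ {α c}ᶜ := fun z hz hzc => hcA (by rw [← mem_singleton_iff.1 hzc]; exact hz)
  have hop : IsOpen (connectedComponentIn {α c}ᶜ (α 0)) :=
    isOpen_compl_singleton.connectedComponentIn
  have hco : IsConnected (connectedComponentIn {α c}ᶜ (α 0)) :=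
    isConnected_connectedComponentIn_iff.2 (hAc h0)
  have hsub := hA.subset_connectedComponentIn h0 hAc
  have hj := (hop.isConnected_iff_isPathConnected.1 hco).joinedIn _ (hsub h0) _ (hsub h1)
  have hne : α 0 ≠ α 1 := fun h => zero_ne_one (iα (by simp) (by simp) h)
  obtain ⟨β, b1, b2, b3, b4, b5⟩ := hp_joined_arc hj hne
  obtain ⟨s, -, hs⟩ := hp_two_arcs hX α β hα b1 iα b2 b3.symm b4.symm c hc
  exact connectedComponentIn_subset _ _ (b5 s) hs

end Helpers

theorem stmt14 {X : Type*} [MetricSpace X] (hX : IsDendrite X)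
    (C : ℕ → Set X) (hconn : ∀ n, IsConnected (C n))
    (hdisj : ∀ m n : ℕ, m ≠ n → Disjoint (C m) (C n)) :
    Filter.Tendsto (fun n => Metric.diam (C n)) Filter.atTop (nhds 0) := by
  obtain ⟨hc, hcon, hlc, hcirc⟩ := hX
  have hlpc : LocallyPathConnectedSpace X := hp_lpc
  by_contra hnot
  have hε : ∃ ε > 0, ∀ N, ∃ n ≥ N, ε ≤ diam (C n) := by
    by_contra hcon'
    push Not at hcon'
    refine hnot (Metric.tendsto_atTop.2 fun ε hε => ?_)
    obtain ⟨N, hN⟩ := hcon' ε hε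
    exact ⟨N, fun n hn => by
      rw [Real.dist_eq, sub_zero, abs_of_nonneg diam_nonneg]; exact hN n hn⟩
  obtain ⟨ε, hε, hN⟩ := hε
  obtain ⟨φ, hφ, hφd⟩ := Nat.exists_strictMono_subsequence (P := fun n => ε ≤ diam (C n)) (fun N =>
    (hN (N + 1)).imp fun n h => ⟨h.1, h.2⟩)
  have hpts : ∀ n, ∃ z : X × X, z.1 ∈ C (φ n) ∧ z.2 ∈ C (φ n) ∧ ε / 2 ≤ dist z.1 z.2 := by
    intro n
    by_contra hcon'
    push Not at hcon'
    have : diam (C (φ n)) ≤ ε / 2 := diam_le_of_forall_dist_le (by positivity)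
      fun x hx y hy => (hcon' (x, y) hx hy).le
    linarith [hφd n]
  choose z hz1 hz2 hz3 using hpts
  obtain ⟨⟨x, y⟩, ψ, hψ, hlim⟩ := CompactSpace.tendsto_subseq z
  have hl1 : Tendsto (fun n => (z (ψ n)).1) atTop (nhds x) := (continuous_fst.tendsto _).comp hlim
  have hl2 : Tendsto (fun n => (z (ψ n)).2) atTop (nhds y) := (continuous_snd.tendsto _).comp hlim
  have hxy : ε / 2 ≤ dist x y := ge_of_tendsto' (hl1.dist hl2) fun n => hz3 (ψ n)
  have hne : x ≠ y := by
    rintro rfl; rw [dist_self] at hxy; linarith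
  obtain ⟨U', V', hU', hV', hxU', hyV', hUV'⟩ := t2_separation hne
  obtain ⟨U, hUs, hU, hxU, hUc⟩ := locallyConnectedSpace_iff_subsets_isOpen_isConnected.1 hlc x U'
    (hU'.mem_nhds hxU')
  obtain ⟨V, hVs, hV, hyV, hVc⟩ := locallyConnectedSpace_iff_subsets_isOpen_isConnected.1 hlc y V'
    (hV'.mem_nhds hyV')
  have hUV : Disjoint U V := hUV'.mono hUs hVs
  obtain ⟨N, hN⟩ := eventually_atTop.1
    ((hl1.eventually (hU.mem_nhds hxU)).and (hl2.eventually (hV.mem_nhds hyV)))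
  have hconU : ∀ n ≥ N, IsPreconnected (U ∪ C (φ (ψ n)) ∪ V) := by
    intro n hn
    obtain ⟨h1, h2⟩ := hN n hn
    have h3 := IsPreconnected.union _ h1 (hz1 (ψ n)) hUc.isPreconnected (hconn _).isPreconnected
    exact IsPreconnected.union _ (Or.inr (hz2 (ψ n))) h2 h3 hVc.isPreconnected
  have hpc : PathConnectedSpace X := pathConnectedSpace_iff_connectedSpace.2 hcon
  obtain ⟨α, a1, a2, a3, a4, -⟩ := hp_joined_arc
    (joinedIn_univ.2 (hpc.joined x y)) hne
  have hin : α '' Icc 0 1 ⊆ U ∪ V := by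
    rintro _ ⟨t, ht, rfl⟩
    have g : ∀ n ≥ N, α t ∈ U ∪ C (φ (ψ n)) ∪ V := fun n hn =>
      hp_arc_sub hcirc α a1 a2 (hconU n hn) (by rw [a3]; exact Or.inl (Or.inl hxU))
        (by rw [a4]; exact Or.inr hyV) t ht
    rcases g N le_rfl with (h | h) | h
    · exact Or.inl h
    · rcases g (N + 1) (Nat.le_succ _) with (h' | h') | h'
      · exact Or.inl h'
      · exact absurd h' (disjoint_left.1 (hdisj _ _
          (fun e => absurd (hψ.injective (hφ.injective e)) (by omega))) h)
      · exact Or.inr h'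
    · exact Or.inr h
  have hpre : IsPreconnected (α '' Icc 0 1) := isPreconnected_Icc.image _ a1.continuousOn
  obtain ⟨w, -, hw1, hw2⟩ := hpre U V hU hV hin ⟨x, ⟨0, by simp, a3⟩, hxU⟩ ⟨y, ⟨1, by simp, a4⟩, hyV⟩
  exact disjoint_left.1 hUV hw1 hw2
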